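/- Let M be a spacelike surface in ℝ^{3,1} with a canonical normal null direction Z such that a ≠ 0. Then at every point of M one has Δ = K², where K is the Gauss curvature of M; in particular Δ ≥ 0 and there exist asymptotic directions at every point of M. -/

import Mathlib

noncomputable section

/-- Points of the parameter domain of the surface chart. -/
abbrev Pt : Type := ℝ × ℝ

/-- Vectors of the Minkowski space `ℝ^{3,1}`. -/
abbrev E4 : Type := Fin 4 → ℝ

/-- The Minkowski bilinear form of signature `(+,+,+,-)` on `ℝ⁴`. -/
def mink (v w : E4) : ℝ := v 0 * w 0 + v 1 * w 1 + v 2 * w 2 - v 3 * w 3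

/-- Realization in `ℝ^{3,1}` of a coordinate vector field `X` along the immersion `ψ`. -/
def vecF (ψ : Pt → E4) (X : Pt → Pt) : Pt → E4 := fun p => fderiv ℝ ψ p (X p)

/-- Flat (ambient) derivative of an `ℝ⁴`-valued field along a coordinate vector field. -/
def Dflat (X : Pt → Pt) (V : Pt → E4) : Pt → E4 := fun p => fderiv ℝ V p (X p)

/-- Second fundamental form `B(X,Y) = ∇̄_X Y − ∇_X Y`. -/
def sff (ψ : Pt → E4) (conn : (Pt → Pt) → (Pt → Pt) → Pt → Pt) (X Y : Pt → Pt) : Pt → E4 :=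
  fun p => Dflat X (vecF ψ Y) p - vecF ψ (conn X Y) p

/-- `v` is tangent to the surface at `p`. -/
def isTangentV (ψ : Pt → E4) (p : Pt) (v : E4) : Prop := ∃ w : Pt, fderiv ℝ ψ p w = v

/-- `v` is normal to the surface at `p`. -/
def isNormalV (ψ : Pt → E4) (p : Pt) (v : E4) : Prop := ∀ w : Pt, mink v (fderiv ℝ ψ p w) = 0

/-- Lie bracket of coordinate vector fields on the chart. -/
def lieB (X Y : Pt → Pt) : Pt → Pt := fun p => fderiv ℝ Y p (X p) - fderiv ℝ X p (Y p)

/-- Curvature tensor `R(X,Y)V = ∇_Y∇_X V − ∇_X∇_Y V + ∇_{[X,Y]}V`. -/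
def curvR (conn : (Pt → Pt) → (Pt → Pt) → Pt → Pt) (X Y V : Pt → Pt) : Pt → Pt :=
  fun p => conn Y (conn X V) p - conn X (conn Y V) p + conn (lieB X Y) V p

/-- Normal curvature tensor `R^⊥(X,Y)ν = ∇⊥_Y∇⊥_X ν − ∇⊥_X∇⊥_Y ν + ∇⊥_{[X,Y]}ν`. -/
def curvRperp (nconn : (Pt → Pt) → (Pt → E4) → Pt → E4) (X Y : Pt → Pt) (ν : Pt → E4) :
    Pt → E4 :=
  fun p => nconn Y (nconn X ν) p - nconn X (nconn Y ν) p + nconn (lieB X Y) ν p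

/-- Determinant of four vectors of `ℝ⁴` (the volume form `e₁∧e₂∧e₃∧e₄ ↦ 1`). -/
def det4 (a b c d : E4) : ℝ := Matrix.det (Matrix.of ![a, b, c, d])

/-- A spacelike surface in `ℝ^{3,1}`, given by a chart `ψ : U → ℝ^{3,1}`, endowed with a
canonical normal null direction with respect to the constant unit spacelike vector `Z`,
together with all the associated geometric data: the Levi-Civita connection `conn`,
the normal connection `nconn`, the tangent part `Z^⊤` (coordinates `ZT`), the oriented
orthonormal completion `W` (coordinates `Wc`), the shape operator `shA = A_{Z^⊥}`,
the 1-form `β` with `B(X,Z^⊤) = β(X)Z^⊥`, and the lightlike normal field `W'` with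
`⟨Z^⊥,W'⟩ = 1`.  Each piece of data is characterized by its defining property. -/
structure CNND where
  U : Set Pt
  hUopen : IsOpen U
  ψ : Pt → E4
  hψ : ContDiffOn ℝ (⊤ : ℕ∞) ψ U
  himm : ∀ p ∈ U, ∀ v : Pt, fderiv ℝ ψ p v = 0 → v = 0
  hspacelike : ∀ p ∈ U, ∀ v : Pt, v ≠ 0 → 0 < mink (fderiv ℝ ψ p v) (fderiv ℝ ψ p v)
  /-- Levi-Civita connection of the induced metric, as the tangent part of the flat one. -/
  conn : (Pt → Pt) → (Pt → Pt) → Pt → Pt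
  hconn : ∀ X Y, ∀ p ∈ U, DifferentiableAt ℝ (vecF ψ Y) p → isNormalV ψ p (sff ψ conn X Y p)
  hconnSmooth : ∀ X Y, ContDiffOn ℝ (⊤ : ℕ∞) X U → ContDiffOn ℝ (⊤ : ℕ∞) Y U → ContDiffOn ℝ (⊤ : ℕ∞) (conn X Y) U
  /-- Normal connection: the normal part of the flat derivative of a normal field. -/
  nconn : (Pt → Pt) → (Pt → E4) → Pt → E4
  hnconn : ∀ X ν, ∀ p ∈ U, (∀ q ∈ U, isNormalV ψ q (ν q)) → DifferentiableAt ℝ ν p →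
    isNormalV ψ p (nconn X ν p) ∧ isTangentV ψ p (Dflat X ν p - nconn X ν p)
  hnconnSmooth : ∀ X ν, ContDiffOn ℝ (⊤ : ℕ∞) X U → (∀ q ∈ U, isNormalV ψ q (ν q)) →
    ContDiffOn ℝ (⊤ : ℕ∞) ν U → ContDiffOn ℝ (⊤ : ℕ∞) (nconn X ν) U
  /-- The parallel (constant) vector field `Z`, a unit spacelike vector. -/
  Z : E4
  hZunit : mink Z Z = 1
  /-- Coordinates of the tangent part `Z^⊤` of `Z`; `Z^⊥ = Z − Z^⊤` is normal. -/
  ZT : Pt → Pt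
  hZTsmooth : ContDiffOn ℝ (⊤ : ℕ∞) ZT U
  hZTtangentpart : ∀ p ∈ U, isNormalV ψ p (Z - fderiv ℝ ψ p (ZT p))
  /-- canonical normal null direction: `Z^⊥` is lightlike … -/
  hZperpNull : ∀ p ∈ U, mink (Z - fderiv ℝ ψ p (ZT p)) (Z - fderiv ℝ ψ p (ZT p)) = 0
  /-- … and nowhere zero. -/
  hZperpNe : ∀ p ∈ U, Z - fderiv ℝ ψ p (ZT p) ≠ 0
  /-- Coordinates of the unit tangent field `W` orthogonal to `Z^⊤`, positively oriented. -/
  Wc : Pt → Pt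
  hWsmooth : ContDiffOn ℝ (⊤ : ℕ∞) Wc U
  hWunit : ∀ p ∈ U, mink (fderiv ℝ ψ p (Wc p)) (fderiv ℝ ψ p (Wc p)) = 1
  hWorth : ∀ p ∈ U, mink (fderiv ℝ ψ p (ZT p)) (fderiv ℝ ψ p (Wc p)) = 0
  hWorient : ∀ p ∈ U, 0 < (ZT p).1 * (Wc p).2 - (ZT p).2 * (Wc p).1
  /-- The shape operator `A_{Z^⊥}`: `⟨A_{Z^⊥}X, Y⟩ = ⟨B(X,Y), Z^⊥⟩`. -/
  shA : (Pt → Pt) → Pt → Pt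
  hshA : ∀ X Y, ∀ p ∈ U, DifferentiableAt ℝ (vecF ψ Y) p →
    mink (fderiv ℝ ψ p (shA X p)) (fderiv ℝ ψ p (Y p)) =
      mink (sff ψ conn X Y p) (Z - fderiv ℝ ψ p (ZT p))
  /-- The 1-form `β` with `B(X, Z^⊤) = β(X) Z^⊥`. -/
  beta : Pt → Pt → ℝ
  hbeta : ∀ X, ∀ p ∈ U, sff ψ conn X ZT p = beta p (X p) • (Z - fderiv ℝ ψ p (ZT p))
  /-- The lightlike normal field `W'` with `⟨Z^⊥, W'⟩ = 1`, such that
  `(Z^⊤, W, (Z^⊥+W')/√2, (Z^⊥−W')/√2)` is a positively oriented orthonormal frame. -/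
  Wp : Pt → E4
  hWpNormal : ∀ p ∈ U, isNormalV ψ p (Wp p)
  hWpNull : ∀ p ∈ U, mink (Wp p) (Wp p) = 0
  hWpPair : ∀ p ∈ U, mink (Z - fderiv ℝ ψ p (ZT p)) (Wp p) = 1
  hWpOrient : ∀ p ∈ U, 0 < det4 (fderiv ℝ ψ p (ZT p)) (fderiv ℝ ψ p (Wc p))
    ((Real.sqrt 2)⁻¹ • ((Z - fderiv ℝ ψ p (ZT p)) + Wp p))
    ((Real.sqrt 2)⁻¹ • ((Z - fderiv ℝ ψ p (ZT p)) - Wp p))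

namespace CNND

variable (S : CNND)

/-- The normal part `Z^⊥` of `Z` along the surface. -/
def Zperp : Pt → E4 := fun p => S.Z - fderiv ℝ S.ψ p (S.ZT p)

/-- The second fundamental form of the surface. -/
def B : (Pt → Pt) → (Pt → Pt) → Pt → E4 := sff S.ψ S.conn

/-- The function `a = α(W) = ⟨B(W,W), Z^⊥⟩`. -/
def afun : Pt → ℝ := fun p => mink (S.B S.Wc S.Wc p) (S.Zperp p)

/-- The 1-form `α(X) = ⟨B(X,W), Z^⊥⟩`. -/
def alphaF (X : Pt → Pt) : Pt → ℝ := fun p => mink (S.B X S.Wc p) (S.Zperp p)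

/-- The mean curvature vector `H⃗ = (1/2)(B(Z^⊤,Z^⊤) + B(W,W))`. -/
def Hvec : Pt → E4 := fun p => (1 / 2 : ℝ) • (S.B S.ZT S.ZT p + S.B S.Wc S.Wc p)

/-- The Gauss curvature `K = ⟨R(Z^⊤,W)Z^⊤, W⟩`. -/
def Kfun : Pt → ℝ := fun p =>
  mink (fderiv ℝ S.ψ p (curvR S.conn S.ZT S.Wc S.ZT p)) (fderiv ℝ S.ψ p (S.Wc p))

/-- The normal curvature `K_N = ⟨R^⊥(Z^⊤,W)Z^⊥, W'⟩`. -/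
def KNfun : Pt → ℝ := fun p => mink (curvRperp S.nconn S.ZT S.Wc S.Zperp p) (S.Wp p)

end CNND

/-- The wedge `v ∧ w` of two vectors of `ℝ⁴`, as an antisymmetric matrix (bivector). -/
def wedge2 (v w : E4) : Fin 4 → Fin 4 → ℝ := fun i j => v i * w j - v j * w i

/-- The Gauss map `G = Z^⊤ ∧ W : M → Λ²ℝ^{3,1}`. -/
def CNND.Gmap (S : CNND) : Pt → Fin 4 → Fin 4 → ℝ :=
  fun p => wedge2 (fderiv ℝ S.ψ p (S.ZT p)) (fderiv ℝ S.ψ p (S.Wc p))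

/-- The signs of the Minkowski metric. -/
def epsM : Fin 4 → ℝ := fun i => if i = 3 then -1 else 1

/-- The induced (signature `(3,3)`) inner product on bivectors of `ℝ^{3,1}`:
`⟨v∧w, v'∧w'⟩ = ⟨v,v'⟩⟨w,w'⟩ − ⟨v,w'⟩⟨w,v'⟩`. -/
def binner (η η' : Fin 4 → Fin 4 → ℝ) : ℝ :=
  (1 / 2) * ∑ i : Fin 4, ∑ j : Fin 4, epsM i * epsM j * η i j * η' i j

/-- The wedge product `Λ²ℝ^{3,1} × Λ²ℝ^{3,1} → Λ⁴ℝ^{3,1} ≅ ℝ`, normalized so that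
`(v∧w)∧(v'∧w') = det(v,w,v',w')`. -/
def bwedge (η η' : Fin 4 → Fin 4 → ℝ) : ℝ :=
  (1 / 4) * ∑ σ : Equiv.Perm (Fin 4),
    ((Equiv.Perm.sign σ : ℤ) : ℝ) * η (σ 0) (σ 1) * η' (σ 2) (σ 3)

/-- The `ℂ`-bilinear form `H(η,η') = ⟨η,η'⟩ + i η∧η'` on bivectors, where `i = −⋆`. -/
def HformC (η η' : Fin 4 → Fin 4 → ℝ) : ℂ :=
  (binner η η' : ℝ) + (bwedge η η' : ℝ) * Complex.I

/-- The quadratic form `δ(u) = dG(u) ∧ dG(u)` whose zero directions are the asymptotic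
directions. -/
def CNND.deltaQ (S : CNND) (p : Pt) (u : Pt) : ℝ :=
  bwedge (fderiv ℝ S.Gmap p u) (fderiv ℝ S.Gmap p u)

/-! ### The Minkowski form -/

lemma mink_comm (v w : E4) : mink v w = mink w v := by simp only [mink]; ring

lemma mink_add_left (u v w : E4) : mink (u + v) w = mink u w + mink v w := by
  simp only [mink, Pi.add_apply]; ring

lemma mink_sub_left (u v w : E4) : mink (u - v) w = mink u w - mink v w := by
  simp only [mink, Pi.sub_apply]; ring

lemma mink_smul_left (c : ℝ) (v w : E4) : mink (c • v) w = c * mink v w := by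
  simp only [mink, Pi.smul_apply, smul_eq_mul]; ring

lemma mink_add_right (u v w : E4) : mink u (v + w) = mink u v + mink u w := by
  simp only [mink, Pi.add_apply]; ring

lemma mink_smul_right (c : ℝ) (v w : E4) : mink v (c • w) = c * mink v w := by
  simp only [mink, Pi.smul_apply, smul_eq_mul]; ring

lemma mink_zero_left (v : E4) : mink 0 v = 0 := by simp [mink]

lemma hasFDerivAt_coord {F : Pt → E4} {p : Pt} (hF : DifferentiableAt ℝ F p) (i : Fin 4) :
    HasFDerivAt (fun q => F q i) ((ContinuousLinearMap.proj i).comp (fderiv ℝ F p)) p :=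
  (hasFDerivAt_pi'.1 hF.hasFDerivAt) i

/-- Product rule for the Minkowski form. -/
lemma fderiv_mink {F G : Pt → E4} {p : Pt} (hF : DifferentiableAt ℝ F p)
    (hG : DifferentiableAt ℝ G p) (u : Pt) :
    fderiv ℝ (fun q => mink (F q) (G q)) p u =
      mink (fderiv ℝ F p u) (G p) + mink (F p) (fderiv ℝ G p u) := by
  have hf := hasFDerivAt_coord hF
  have hg := hasFDerivAt_coord hG
  have h := ((((hf 0).mul (hg 0)).add ((hf 1).mul (hg 1))).add ((hf 2).mul (hg 2))).sub
    ((hf 3).mul (hg 3))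
  have h' : HasFDerivAt (fun q => mink (F q) (G q)) _ p := h
  rw [h'.fderiv]
  simp [mink]
  ring

/-- Product rule for a Minkowski product that is constant near `p`. -/
lemma mink_fderiv_eq_zero {F G : Pt → E4} {p : Pt} {c : ℝ} (hF : DifferentiableAt ℝ F p)
    (hG : DifferentiableAt ℝ G p) (h : (fun q => mink (F q) (G q)) =ᶠ[nhds p] fun _ => c)
    (u : Pt) : mink (fderiv ℝ F p u) (G p) + mink (F p) (fderiv ℝ G p u) = 0 := by
  rw [← fderiv_mink hF hG, h.fderiv_eq]
  simp

/-! ### Bivectors -/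

lemma fderiv_wedge2 {F G : Pt → E4} {p : Pt} (hF : DifferentiableAt ℝ F p)
    (hG : DifferentiableAt ℝ G p) (u : Pt) :
    fderiv ℝ (fun q => wedge2 (F q) (G q)) p u =
      wedge2 (fderiv ℝ F p u) (G p) + wedge2 (F p) (fderiv ℝ G p u) := by
  have hf := hasFDerivAt_coord hF
  have hg := hasFDerivAt_coord hG
  have h : HasFDerivAt (fun q => wedge2 (F q) (G q)) _ p :=
    hasFDerivAt_pi.2 fun i => hasFDerivAt_pi.2 fun j =>
      ((hf i).mul (hg j)).sub ((hf j).mul (hg i))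
  rw [h.fderiv]
  ext i j
  simp [wedge2]
  ring

/-- The wedge product of two bivectors in Plücker coordinates. -/
lemma bwedge_eq_plucker {η η' : Fin 4 → Fin 4 → ℝ} (h : ∀ i j, η i j = -η j i)
    (h' : ∀ i j, η' i j = -η' j i) :
    bwedge η η' = η 0 1 * η' 2 3 - η 0 2 * η' 1 3 + η 0 3 * η' 1 2 +
      η 1 2 * η' 0 3 - η 1 3 * η' 0 2 + η 2 3 * η' 0 1 := by
  unfold bwedge
  simp only [Finset.univ_perm_fin_succ, ← Finset.univ_product_univ, Finset.sum_map,
    Finset.sum_product, Fin.sum_univ_succ, Equiv.toEmbedding_apply, Finset.univ_unique,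
    Finset.sum_singleton]
  have h₂ : ∀ (k : Fin 4) (e : Equiv.Perm (Fin 3)),
      Equiv.Perm.decomposeFin.symm (k, e) 2 = Equiv.swap 0 k (e 1).succ :=
    fun k e => Equiv.Perm.decomposeFin_symm_apply_succ e k 1
  have h₃ : ∀ (k : Fin 4) (e : Equiv.Perm (Fin 3)),
      Equiv.Perm.decomposeFin.symm (k, e) 3 = Equiv.swap 0 k (e 2).succ :=
    fun k e => Equiv.Perm.decomposeFin_symm_apply_succ e k 2
  have h₂' : ∀ (k : Fin 3) (e : Equiv.Perm (Fin 2)),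
      Equiv.Perm.decomposeFin.symm (k, e) 2 = Equiv.swap 0 k (e 1).succ :=
    fun k e => Equiv.Perm.decomposeFin_symm_apply_succ e k 1
  simp [Equiv.Perm.decomposeFin.symm_sign, h₂, h₃, h₂', Equiv.swap_apply_def]
  rw [h 1 0, h 2 0, h 3 0, h 2 1, h 3 1, h 3 2, h' 1 0, h' 2 0, h' 3 0, h' 2 1, h' 3 1, h' 3 2]
  ring

/-- The squared determinant of four vectors is minus their Gram determinant. -/
lemma det_sq_eq_neg_gram (v : Fin 4 → E4) :
    (Matrix.of v).det ^ 2 = -(Matrix.of fun i j => mink (v i) (v j)).det := by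
  have h : (Matrix.of fun i j => mink (v i) (v j)) =
      Matrix.of v * Matrix.diagonal epsM * (Matrix.of v).transpose := by
    ext i j
    rw [Matrix.mul_apply]
    simp only [Matrix.mul_diagonal, Fin.sum_univ_four]
    simp [mink, epsM]
    ring
  rw [h, Matrix.det_mul, Matrix.det_mul, Matrix.det_transpose, Matrix.det_diagonal]
  simp [epsM]
  ring

/-- If `t, v` are orthonormal, `n` is null and `t, v ⟂ n, b`, then `det(t,v,n,b)² = ⟨n,b⟩²`. -/
lemma det4_sq_of_null {t v n b : E4} (htt : mink t t = 1) (htv : mink t v = 0)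
    (hvv : mink v v = 1) (hnt : mink n t = 0) (hnv : mink n v = 0) (hnn : mink n n = 0)
    (hbt : mink b t = 0) (hbv : mink b v = 0) :
    det4 t v n b ^ 2 = mink n b ^ 2 := by
  rw [det4, det_sq_eq_neg_gram]
  simp [Matrix.det_succ_row_zero, Fin.sum_univ_succ, Fin.succAbove, htt, htv, hvv, hnt, hnv, hnn,
    hbt, hbv, mink_comm v t, mink_comm v n, mink_comm v b,
    mink_comm b n]
  ring

lemma det4_eq_plucker (a b c d : E4) : det4 a b c d =
    wedge2 a b 0 1 * wedge2 c d 2 3 - wedge2 a b 0 2 * wedge2 c d 1 3 +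
      wedge2 a b 0 3 * wedge2 c d 1 2 + wedge2 a b 1 2 * wedge2 c d 0 3 -
      wedge2 a b 1 3 * wedge2 c d 0 2 + wedge2 a b 2 3 * wedge2 c d 0 1 := by
  simp [det4, Matrix.det_succ_row_zero, Fin.sum_univ_succ, Fin.succAbove, wedge2]
  ring

/-- The bivectors `x n∧v + t∧(y n)` are isotropic for the wedge product. -/
lemma bwedge_null_self (t v n : E4) (x y : ℝ) :
    bwedge (wedge2 (x • n) v + wedge2 t (y • n)) (wedge2 (x • n) v + wedge2 t (y • n)) = 0 := by
  rw [bwedge_eq_plucker] <;>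
    simp only [wedge2, Pi.add_apply, Pi.smul_apply, smul_eq_mul] <;> intros <;> ring

lemma bwedge_null_right (t v n b : E4) (x y a : ℝ) :
    bwedge (wedge2 (x • n) v + wedge2 t (y • n))
      (wedge2 (a • v + y • n) v + wedge2 t (b - a • t)) = -x * det4 t v n b := by
  rw [bwedge_eq_plucker, det4_eq_plucker] <;>
    simp only [wedge2, Pi.add_apply, Pi.sub_apply, Pi.smul_apply, smul_eq_mul] <;> intros <;> ring

/-! ### Flat derivatives -/

lemma contDiffOn_Dflat {U : Set Pt} (hU : IsOpen U) {F : Pt → E4} {X : Pt → Pt}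
    (hF : ContDiffOn ℝ (⊤ : ℕ∞) F U) (hX : ContDiffOn ℝ (⊤ : ℕ∞) X U) :
    ContDiffOn ℝ (⊤ : ℕ∞) (Dflat X F) U :=
  (hF.fderiv_of_isOpen hU (by norm_cast)).clm_apply hX

/-- The flat connection has no curvature: `D_X D_Y F − D_Y D_X F = D_{[X,Y]} F`. -/
lemma Dflat_Dflat_sub {U : Set Pt} (hU : IsOpen U) {F : Pt → E4} {X Y : Pt → Pt}
    (hF : ContDiffOn ℝ (⊤ : ℕ∞) F U) (hX : ContDiffOn ℝ (⊤ : ℕ∞) X U)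
    (hY : ContDiffOn ℝ (⊤ : ℕ∞) Y U) {p : Pt} (hp : p ∈ U) :
    Dflat X (Dflat Y F) p - Dflat Y (Dflat X F) p = fderiv ℝ F p (lieB X Y p) := by
  have hn := hU.mem_nhds hp
  have hdF : DifferentiableAt ℝ (fderiv ℝ F) p :=
    ((hF.fderiv_of_isOpen hU (m := (⊤ : ℕ∞)) (by norm_cast)).contDiffAt hn).differentiableAt
      (by simp)
  have hdX := (hX.contDiffAt hn).differentiableAt (by simp)
  have hdY := (hY.contDiffAt hn).differentiableAt (by simp)
  have hs : IsSymmSndFDerivAt ℝ F p := (hF.contDiffAt hn).isSymmSndFDerivAt (by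
    simp [minSmoothness_of_isRCLikeNormedField]; norm_cast)
  have key : ∀ A : Pt → Pt, DifferentiableAt ℝ A p → ∀ v, fderiv ℝ (Dflat A F) p v =
      fderiv ℝ (fderiv ℝ F) p v (A p) + fderiv ℝ F p (fderiv ℝ A p v) := by
    intro A hA v
    have : HasFDerivAt (Dflat A F) _ p := hdF.hasFDerivAt.clm_apply hA.hasFDerivAt
    rw [this.fderiv]
    simp [add_comm]
  change fderiv ℝ (Dflat Y F) p (X p) - fderiv ℝ (Dflat X F) p (Y p) = _
  rw [key Y hdY, key X hdX, hs.eq (X p) (Y p), lieB, map_sub]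
  abel

/-! ### Surfaces with a canonical normal null direction -/

namespace CNND

variable (S : CNND) {p : Pt}

/-- The tangent part `Z^⊤`, as a vector field of `ℝ^{3,1}` along the surface. -/
def tanZ : Pt → E4 := vecF S.ψ S.ZT

/-- The field `W`, as a vector field of `ℝ^{3,1}` along the surface. -/
def vecW : Pt → E4 := vecF S.ψ S.Wc

lemma contDiffOn_vecF {X : Pt → Pt} (hX : ContDiffOn ℝ (⊤ : ℕ∞) X S.U) :
    ContDiffOn ℝ (⊤ : ℕ∞) (vecF S.ψ X) S.U :=
  contDiffOn_Dflat S.hUopen S.hψ hX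

lemma contDiffOn_tanZ : ContDiffOn ℝ (⊤ : ℕ∞) S.tanZ S.U := S.contDiffOn_vecF S.hZTsmooth

lemma contDiffOn_vecW : ContDiffOn ℝ (⊤ : ℕ∞) S.vecW S.U := S.contDiffOn_vecF S.hWsmooth

variable {S}

lemma differentiableAt_of_contDiffOn {F : Pt → E4} (hF : ContDiffOn ℝ (⊤ : ℕ∞) F S.U)
    (hp : p ∈ S.U) : DifferentiableAt ℝ F p :=
  (hF.contDiffAt (S.hUopen.mem_nhds hp)).differentiableAt (by simp)

lemma eventuallyEq_of_eq {F G : Pt → ℝ} (h : ∀ q ∈ S.U, F q = G q) (hp : p ∈ S.U) :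
    F =ᶠ[nhds p] G :=
  Filter.eventuallyEq_of_mem (S.hUopen.mem_nhds hp) h

lemma Z_eq (p : Pt) : S.Z = S.Zperp p + S.tanZ p := (sub_add_cancel _ _).symm

lemma mink_Zperp_tangent (hp : p ∈ S.U) (w : Pt) : mink (S.Zperp p) (fderiv ℝ S.ψ p w) = 0 :=
  S.hZTtangentpart p hp w

lemma mink_Zperp_tanZ (hp : p ∈ S.U) : mink (S.Zperp p) (S.tanZ p) = 0 :=
  S.hZTtangentpart p hp _

lemma mink_Zperp_vecW (hp : p ∈ S.U) : mink (S.Zperp p) (S.vecW p) = 0 :=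
  S.hZTtangentpart p hp _

lemma mink_Zperp_Zperp (hp : p ∈ S.U) : mink (S.Zperp p) (S.Zperp p) = 0 := S.hZperpNull p hp

lemma mink_tanZ_vecW (hp : p ∈ S.U) : mink (S.tanZ p) (S.vecW p) = 0 := S.hWorth p hp

lemma mink_vecW_vecW (hp : p ∈ S.U) : mink (S.vecW p) (S.vecW p) = 1 := S.hWunit p hp

lemma mink_tanZ_tanZ (hp : p ∈ S.U) : mink (S.tanZ p) (S.tanZ p) = 1 := by
  have h := S.hZunit
  rw [Z_eq p, mink_add_left, mink_add_right, mink_add_right, mink_Zperp_Zperp hp,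
    mink_comm (S.tanZ p) (S.Zperp p), mink_Zperp_tanZ hp] at h
  linarith

lemma mink_Z_vecW (hp : p ∈ S.U) : mink S.Z (S.vecW p) = 0 := by
  rw [Z_eq p, mink_add_left, mink_Zperp_vecW hp, mink_tanZ_vecW hp, add_zero]

/-- Tangent vectors decompose in the orthonormal frame `(Z^⊤, W)`. -/
lemma tangent_eq (hp : p ∈ S.U) (w : Pt) : fderiv ℝ S.ψ p w =
    mink (fderiv ℝ S.ψ p w) (S.tanZ p) • S.tanZ p +
      mink (fderiv ℝ S.ψ p w) (S.vecW p) • S.vecW p := by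
  obtain ⟨c, d, rfl⟩ : ∃ c d : ℝ, w = c • S.ZT p + d • S.Wc p := by
    have h := (S.hWorient p hp).ne'
    set D := (S.ZT p).1 * (S.Wc p).2 - (S.ZT p).2 * (S.Wc p).1 with hD
    refine ⟨(w.1 * (S.Wc p).2 - w.2 * (S.Wc p).1) / D,
      ((S.ZT p).1 * w.2 - (S.ZT p).2 * w.1) / D, ?_⟩
    ext <;> simp <;> field_simp <;> rw [hD] <;> ring
  have h : fderiv ℝ S.ψ p (c • S.ZT p + d • S.Wc p) = c • S.tanZ p + d • S.vecW p := by
    rw [map_add, map_smul, map_smul]; rfl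
  rw [h]
  simp only [mink_add_left, mink_smul_left, mink_tanZ_tanZ hp, mink_tanZ_vecW hp,
    mink_vecW_vecW hp, mink_comm (S.vecW p) (S.tanZ p)]
  simp

/-- The tangent part of `D_X Y` is `∇_X Y`. -/
lemma mink_conn (hp : p ∈ S.U) (X Y : Pt → Pt) (hY : DifferentiableAt ℝ (vecF S.ψ Y) p)
    (w : Pt) : mink (fderiv ℝ S.ψ p (S.conn X Y p)) (fderiv ℝ S.ψ p w) =
      mink (fderiv ℝ (vecF S.ψ Y) p (X p)) (fderiv ℝ S.ψ p w) := by
  have h := S.hconn X Y p hp hY w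
  rw [sff, mink_sub_left] at h
  exact (sub_eq_zero.1 h).symm

lemma fderiv_tanZ_eq_conn (hp : p ∈ S.U) (X : Pt → Pt) : fderiv ℝ S.tanZ p (X p) =
    fderiv ℝ S.ψ p (S.conn X S.ZT p) + S.beta p (X p) • S.Zperp p :=
  sub_eq_iff_eq_add'.1 (S.hbeta X p hp)

lemma mink_fderiv_tanZ_tanZ (hp : p ∈ S.U) (u : Pt) :
    mink (fderiv ℝ S.tanZ p u) (S.tanZ p) = 0 := by
  have hd := differentiableAt_of_contDiffOn S.contDiffOn_tanZ hp
  have h := mink_fderiv_eq_zero hd hd (eventuallyEq_of_eq (fun q hq => mink_tanZ_tanZ hq) hp) u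
  rw [mink_comm (S.tanZ p)] at h
  linarith

lemma mink_fderiv_vecW_vecW (hp : p ∈ S.U) (u : Pt) :
    mink (fderiv ℝ S.vecW p u) (S.vecW p) = 0 := by
  have hd := differentiableAt_of_contDiffOn S.contDiffOn_vecW hp
  have h := mink_fderiv_eq_zero hd hd (eventuallyEq_of_eq (fun q hq => mink_vecW_vecW hq) hp) u
  rw [mink_comm (S.vecW p)] at h
  linarith

lemma mink_fderiv_vecW_tanZ (hp : p ∈ S.U) (u : Pt) :
    mink (fderiv ℝ S.vecW p u) (S.tanZ p) = -mink (fderiv ℝ S.tanZ p u) (S.vecW p) := by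
  have h := mink_fderiv_eq_zero (differentiableAt_of_contDiffOn S.contDiffOn_tanZ hp)
    (differentiableAt_of_contDiffOn S.contDiffOn_vecW hp)
    (eventuallyEq_of_eq (fun q hq => mink_tanZ_vecW hq) hp) u
  rw [mink_comm (S.tanZ p)] at h
  linarith

lemma mink_fderiv_vecW_Zperp (hp : p ∈ S.U) (u : Pt) :
    mink (fderiv ℝ S.vecW p u) (S.Zperp p) = mink (fderiv ℝ S.tanZ p u) (S.vecW p) := by
  have h := mink_fderiv_eq_zero (differentiableAt_const S.Z)
    (differentiableAt_of_contDiffOn S.contDiffOn_vecW hp)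
    (eventuallyEq_of_eq (fun q hq => mink_Z_vecW hq) hp) u
  rw [Z_eq p, mink_add_left, mink_comm (S.tanZ p), mink_comm (S.Zperp p),
    mink_fderiv_vecW_tanZ hp] at h
  simp only [fderiv_const_apply, zero_apply, mink_zero_left] at h
  linarith

/-- `∇_X Z^⊤ = α(X) W`. -/
lemma tangent_conn_tanZ (hp : p ∈ S.U) (X : Pt → Pt) : fderiv ℝ S.ψ p (S.conn X S.ZT p) =
    mink (fderiv ℝ S.tanZ p (X p)) (S.vecW p) • S.vecW p := by
  have hd : DifferentiableAt ℝ (vecF S.ψ S.ZT) p :=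
    differentiableAt_of_contDiffOn S.contDiffOn_tanZ hp
  have h₁ : mink _ (S.tanZ p) = _ := mink_conn hp X S.ZT hd (S.ZT p)
  have h₂ : mink _ (S.vecW p) = _ := mink_conn hp X S.ZT hd (S.Wc p)
  rw [tangent_eq hp, h₁, h₂]
  have h₃ := mink_fderiv_tanZ_tanZ hp (X p)
  simp only [tanZ, vecF, vecW] at h₃ ⊢
  rw [h₃, zero_smul, zero_add]

lemma fderiv_tanZ (hp : p ∈ S.U) (X : Pt → Pt) : fderiv ℝ S.tanZ p (X p) =
    mink (fderiv ℝ S.tanZ p (X p)) (S.vecW p) • S.vecW p + S.beta p (X p) • S.Zperp p := by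
  rw [← tangent_conn_tanZ hp]
  exact fderiv_tanZ_eq_conn hp X

lemma mink_fderiv_tanZ_Zperp (hp : p ∈ S.U) (X : Pt → Pt) :
    mink (fderiv ℝ S.tanZ p (X p)) (S.Zperp p) = 0 := by
  rw [fderiv_tanZ hp, mink_add_left, mink_smul_left, mink_smul_left, mink_Zperp_Zperp hp,
    mink_comm (S.vecW p), mink_Zperp_vecW hp]
  ring

lemma tangent_lieB (hp : p ∈ S.U) : fderiv ℝ S.vecW p (S.ZT p) - fderiv ℝ S.tanZ p (S.Wc p) =
    fderiv ℝ S.ψ p (lieB S.ZT S.Wc p) :=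
  Dflat_Dflat_sub S.hUopen S.hψ S.hZTsmooth S.hWsmooth hp

/-- `α(Z^⊤) = 0`. -/
lemma mink_fderiv_tanZ_ZT_vecW (hp : p ∈ S.U) :
    mink (fderiv ℝ S.tanZ p (S.ZT p)) (S.vecW p) = 0 := by
  rw [← mink_fderiv_vecW_Zperp hp, ← sub_add_cancel (fderiv ℝ S.vecW p (S.ZT p)),
    tangent_lieB hp, mink_add_left, mink_fderiv_tanZ_Zperp hp, mink_comm, mink_Zperp_tangent hp,
    add_zero]

lemma fderiv_tanZ_ZT (hp : p ∈ S.U) :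
    fderiv ℝ S.tanZ p (S.ZT p) = S.beta p (S.ZT p) • S.Zperp p := by
  rw [fderiv_tanZ hp, mink_fderiv_tanZ_ZT_vecW hp, zero_smul, zero_add]

/-- The function `a`, in the form `⟨∇̄_W Z^⊤, W⟩`. -/
def coeffA (S : CNND) (p : Pt) : ℝ := mink (fderiv ℝ S.tanZ p (S.Wc p)) (S.vecW p)

/-- `[Z^⊤, W] = -a W`. -/
lemma lieB_eq (hp : p ∈ S.U) : lieB S.ZT S.Wc p = -S.coeffA p • S.Wc p := by
  have h : fderiv ℝ S.ψ p (lieB S.ZT S.Wc p) = -S.coeffA p • S.vecW p := by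
    rw [tangent_eq hp, ← tangent_lieB hp]
    simp only [mink_sub_left, mink_fderiv_tanZ_tanZ hp, mink_fderiv_vecW_tanZ hp,
      mink_fderiv_vecW_vecW hp, mink_fderiv_tanZ_ZT_vecW hp, coeffA]
    simp
  rw [← sub_eq_zero]
  refine S.himm p hp _ ?_
  rw [map_sub, map_smul, h]
  exact sub_self _

lemma fderiv_tanZ_Wc (hp : p ∈ S.U) : fderiv ℝ S.tanZ p (S.Wc p) =
    S.coeffA p • S.vecW p + S.beta p (S.Wc p) • S.Zperp p :=
  fderiv_tanZ hp S.Wc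

lemma fderiv_vecW_ZT (hp : p ∈ S.U) :
    fderiv ℝ S.vecW p (S.ZT p) = S.beta p (S.Wc p) • S.Zperp p := by
  rw [← sub_add_cancel (fderiv ℝ S.vecW p (S.ZT p)), tangent_lieB hp, lieB_eq hp,
    fderiv_tanZ_Wc hp, map_smul]
  change -S.coeffA p • S.vecW p + _ = _
  module

/-- `Z^⊤(a) = -a² - a β(Z^⊤)`. -/
lemma fderiv_coeffA_ZT (hp : p ∈ S.U) : fderiv ℝ S.coeffA p (S.ZT p) =
    -S.coeffA p ^ 2 - S.coeffA p * S.beta p (S.ZT p) := by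
  have hT := S.contDiffOn_tanZ
  have hdV := differentiableAt_of_contDiffOn S.contDiffOn_vecW hp
  have hWT := differentiableAt_of_contDiffOn (contDiffOn_Dflat S.hUopen hT S.hWsmooth) hp
  have hTT := differentiableAt_of_contDiffOn (contDiffOn_Dflat S.hUopen hT S.hZTsmooth) hp
  have hflat := congrArg (mink · (S.vecW p))
    (Dflat_Dflat_sub S.hUopen hT S.hZTsmooth S.hWsmooth hp)
  simp only [mink_sub_left, lieB_eq hp, map_smul, mink_smul_left] at hflat
  have h₁ := fderiv_mink hWT hdV (S.ZT p)
  have h₂ := mink_fderiv_eq_zero hTT hdV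
    (eventuallyEq_of_eq (fun q hq => mink_fderiv_tanZ_ZT_vecW hq) hp) (S.Wc p)
  have h₃ : mink (Dflat S.Wc S.tanZ p) (fderiv ℝ S.vecW p (S.ZT p)) = 0 := by
    rw [fderiv_vecW_ZT hp, mink_smul_right]
    simp only [Dflat, mink_fderiv_tanZ_Zperp hp, mul_zero]
  have h₄ : mink (Dflat S.ZT S.tanZ p) (fderiv ℝ S.vecW p (S.Wc p)) =
      S.beta p (S.ZT p) * S.coeffA p := by
    simp only [Dflat]
    rw [fderiv_tanZ_ZT hp, mink_smul_left, mink_comm, mink_fderiv_vecW_Zperp hp, coeffA]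
  change fderiv ℝ S.coeffA p (S.ZT p) = _ at h₁
  simp only [Dflat] at *
  have h₅ : mink (fderiv ℝ S.tanZ p (S.Wc p)) (S.vecW p) = S.coeffA p := rfl
  rw [h₅] at hflat
  linear_combination h₁ + hflat + h₂ + h₃ - h₄

/-- The Gauss equation: `K = a β(Z^⊤)`. -/
lemma Kfun_eq (hp : p ∈ S.U) : S.Kfun p = S.coeffA p * S.beta p (S.ZT p) := by
  have hcT := S.contDiffOn_vecF (S.hconnSmooth _ _ S.hZTsmooth S.hZTsmooth)
  have hcW := S.contDiffOn_vecF (S.hconnSmooth _ _ S.hWsmooth S.hZTsmooth)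
  have hdV := differentiableAt_of_contDiffOn S.contDiffOn_vecW hp
  have eT := mink_conn hp S.Wc _ (differentiableAt_of_contDiffOn hcT hp) (S.Wc p)
  have eW := mink_conn hp S.ZT _ (differentiableAt_of_contDiffOn hcW hp) (S.Wc p)
  have eL := mink_conn hp (lieB S.ZT S.Wc) S.ZT
    (differentiableAt_of_contDiffOn S.contDiffOn_tanZ hp) (S.Wc p)
  have h₁ : fderiv ℝ (vecF S.ψ (S.conn S.ZT S.ZT)) p = 0 := by
    have : vecF S.ψ (S.conn S.ZT S.ZT) =ᶠ[nhds p] fun _ => 0 :=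
      Filter.eventuallyEq_of_mem (S.hUopen.mem_nhds hp) fun q hq => by
        rw [vecF, tangent_conn_tanZ hq, mink_fderiv_tanZ_ZT_vecW hq, zero_smul]
    rw [this.fderiv_eq]
    simp
  have hC : ∀ q ∈ S.U, vecF S.ψ (S.conn S.Wc S.ZT) q = S.coeffA q • S.vecW q :=
    fun q hq => tangent_conn_tanZ hq S.Wc
  have h₂ : fderiv ℝ S.coeffA p (S.ZT p) =
      mink (fderiv ℝ (vecF S.ψ (S.conn S.Wc S.ZT)) p (S.ZT p)) (S.vecW p) := by
    have h := fderiv_mink (differentiableAt_of_contDiffOn hcW hp) hdV (S.ZT p)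
    have he : (fun q => mink (vecF S.ψ (S.conn S.Wc S.ZT) q) (S.vecW q)) =ᶠ[nhds p] S.coeffA :=
      eventuallyEq_of_eq (fun q hq => by
        rw [hC q hq, mink_smul_left, mink_vecW_vecW hq, mul_one]) hp
    rw [he.fderiv_eq, hC p hp, mink_smul_left, mink_comm (S.vecW p),
      mink_fderiv_vecW_vecW hp] at h
    linarith
  have h₃ : mink (fderiv ℝ S.tanZ p (lieB S.ZT S.Wc p)) (S.vecW p) = -S.coeffA p ^ 2 := by
    rw [lieB_eq hp, map_smul, mink_smul_left, coeffA]
    ring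
  have h₄ := fderiv_coeffA_ZT hp
  rw [Kfun, curvR, map_add, map_sub, mink_add_left, mink_sub_left, eT, eW, eL, h₁]
  simp only [vecW, tanZ, vecF] at h₂ h₃
  simp only [vecF, zero_apply, mink_zero_left] at *
  rw [← h₂, h₃, h₄]
  ring

lemma fderiv_Gmap (hp : p ∈ S.U) (u : Pt) : fderiv ℝ S.Gmap p u =
    wedge2 (fderiv ℝ S.tanZ p u) (S.vecW p) + wedge2 (S.tanZ p) (fderiv ℝ S.vecW p u) :=
  fderiv_wedge2 (differentiableAt_of_contDiffOn S.contDiffOn_tanZ hp)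
    (differentiableAt_of_contDiffOn S.contDiffOn_vecW hp) u

/-- `Z^⊤` is an asymptotic direction. -/
lemma deltaQ_ZT (hp : p ∈ S.U) : S.deltaQ p (S.ZT p) = 0 := by
  rw [deltaQ, fderiv_Gmap hp, fderiv_tanZ_ZT hp, fderiv_vecW_ZT hp, bwedge_null_self]

lemma bwedge_fderiv_Gmap_sq (hp : p ∈ S.U) :
    bwedge (fderiv ℝ S.Gmap p (S.ZT p)) (fderiv ℝ S.Gmap p (S.Wc p)) ^ 2 =
      (S.coeffA p * S.beta p (S.ZT p)) ^ 2 := by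
  set b := fderiv ℝ S.vecW p (S.Wc p) + S.coeffA p • S.tanZ p with hb
  have hbt : mink b (S.tanZ p) = 0 := by
    rw [hb, mink_add_left, mink_smul_left, mink_fderiv_vecW_tanZ hp, mink_tanZ_tanZ hp, coeffA]
    ring
  have hbv : mink b (S.vecW p) = 0 := by
    rw [hb, mink_add_left, mink_smul_left, mink_fderiv_vecW_vecW hp, mink_tanZ_vecW hp]
    ring
  have hnb : mink (S.Zperp p) b = S.coeffA p := by
    rw [hb, mink_add_right, mink_smul_right, mink_comm, mink_fderiv_vecW_Zperp hp,
      mink_Zperp_tanZ hp, coeffA]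
    ring
  rw [fderiv_Gmap hp, fderiv_Gmap hp, fderiv_tanZ_ZT hp, fderiv_vecW_ZT hp, fderiv_tanZ_Wc hp,
    eq_sub_of_add_eq hb.symm, bwedge_null_right, mul_pow, det4_sq_of_null (mink_tanZ_tanZ hp)
      (mink_tanZ_vecW hp) (mink_vecW_vecW hp) (mink_Zperp_tanZ hp) (mink_Zperp_vecW hp)
      (mink_Zperp_Zperp hp) hbt hbv, hnb]
  ring

lemma ZT_ne_zero (hp : p ∈ S.U) : S.ZT p ≠ 0 := by
  intro h
  have := S.hWorient p hp
  simp [h] at this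

end CNND

/-- If `a ≠ 0`, then at every point of `M` one has `Δ = K²`; in particular
`Δ ≥ 0` and there exist asymptotic directions at every point of `M`. -/
theorem cnnd_Delta_eq_K_sq (S : CNND) (ha : ∀ p ∈ S.U, S.afun p ≠ 0)
    (hG : ∀ p ∈ S.U, DifferentiableAt ℝ S.Gmap p) :
    ∀ p ∈ S.U,
      bwedge (fderiv ℝ S.Gmap p (S.ZT p)) (fderiv ℝ S.Gmap p (S.Wc p)) ^ 2 -
          S.deltaQ p (S.ZT p) * S.deltaQ p (S.Wc p) = S.Kfun p ^ 2 ∧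
      0 ≤ bwedge (fderiv ℝ S.Gmap p (S.ZT p)) (fderiv ℝ S.Gmap p (S.Wc p)) ^ 2 -
          S.deltaQ p (S.ZT p) * S.deltaQ p (S.Wc p) ∧
      ∃ u : Pt, u ≠ 0 ∧ S.deltaQ p u = 0 := by
  intro p hp
  have h : bwedge (fderiv ℝ S.Gmap p (S.ZT p)) (fderiv ℝ S.Gmap p (S.Wc p)) ^ 2 -
      S.deltaQ p (S.ZT p) * S.deltaQ p (S.Wc p) = S.Kfun p ^ 2 := by
    rw [CNND.deltaQ_ZT hp, zero_mul, sub_zero, CNND.bwedge_fderiv_Gmap_sq hp, CNND.Kfun_eq hp]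
  exact ⟨h, h ▸ sq_nonneg _, S.ZT p, CNND.ZT_ne_zero hp, CNND.deltaQ_ZT hp⟩

end
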